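/- Let f be a probability density function on ℝ^m with mean vector μ ∈ ℝ^m and symmetric positive definite covariance matrix Σ, and let φ_{μ,Σ} denote the multivariate Gaussian density with mean μ and covariance Σ. Then the cross-entropy integral satisfies ∫_{ℝ^m} f(x) log φ_{μ,Σ}(x) dx = -(1/2) log((2π)^m det(Σ)) - m/2. -/

import Mathlib

open MeasureTheory Filter Matrix ProbabilityTheory
open scoped ENNReal Topology

noncomputable section

/-- Differential Shannon entropy of a density on `ℝ^m`. -/
def shannonEntropy {m : ℕ} (f : EuclideanSpace ℝ (Fin m) → ℝ) : ℝ :=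
  -∫ x, f x * Real.log (f x)

/-- Kullback–Leibler divergence between two densities on `ℝ^m`. -/
def klDiv {m : ℕ} (f g : EuclideanSpace ℝ (Fin m) → ℝ) : ℝ :=
  ∫ x, f x * Real.log (f x / g x)

/-- The multivariate Gaussian density with mean `μ` and covariance `S`. -/
def gaussianDensity {m : ℕ} (μ : EuclideanSpace ℝ (Fin m))
    (S : Matrix (Fin m) (Fin m) ℝ) (x : EuclideanSpace ℝ (Fin m)) : ℝ :=
  (2 * Real.pi) ^ (-(m : ℝ) / 2) * S.det ^ (-(1 : ℝ) / 2) *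
    Real.exp (-(1 / 2) * ((fun i => x i - μ i) ⬝ᵥ (S⁻¹ *ᵥ fun i => x i - μ i)))

/-- `f` is a probability density function on `ℝ^m` (w.r.t. Lebesgue measure). -/
def IsDensity {m : ℕ} (f : EuclideanSpace ℝ (Fin m) → ℝ) : Prop :=
  Measurable f ∧ (∀ x, 0 ≤ f x) ∧ Integrable f ∧ ∫ x, f x = 1

/-- The density `f` has mean vector `μ` (all first moments exist). -/
def HasMean {m : ℕ} (f : EuclideanSpace ℝ (Fin m) → ℝ)
    (μ : EuclideanSpace ℝ (Fin m)) : Prop :=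
  (∀ i, Integrable fun x => f x * x i) ∧ ∀ i, (∫ x, f x * x i) = μ i

/-- The density `f` with mean `μ` has covariance matrix `S`
(all second moments exist). -/
def HasCov {m : ℕ} (f : EuclideanSpace ℝ (Fin m) → ℝ)
    (μ : EuclideanSpace ℝ (Fin m)) (S : Matrix (Fin m) (Fin m) ℝ) : Prop :=
  (∀ i j, Integrable fun x => f x * ((x i - μ i) * (x j - μ j))) ∧
    ∀ i j, (∫ x, f x * ((x i - μ i) * (x j - μ j))) = S i j

/-- The `k`-th smallest element of a multiset of reals (`k = 1` is the minimum). -/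
def kthSmallest (s : Multiset ℝ) (k : ℕ) : ℝ :=
  (s.sort (· ≤ ·)).getD (k - 1) 0

/-- `ρ_{i,k,N}`: Euclidean distance from `X i` to its `k`-th nearest neighbour
among `{X j : j ≠ i, j < N}`. -/
def nnDist {m : ℕ} (X : ℕ → EuclideanSpace ℝ (Fin m)) (i k N : ℕ) : ℝ :=
  kthSmallest (((Finset.range N).erase i).val.map fun j => dist (X i) (X j)) k

/-- `ν_{i,k}`: Euclidean distance from `X i` to its `k`-th nearest neighbour
among `{Y j : j < M}`. -/
def nnDistTo {m : ℕ} (X Y : ℕ → EuclideanSpace ℝ (Fin m)) (i k M : ℕ) : ℝ :=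
  kthSmallest ((Finset.range M).val.map fun j => dist (X i) (Y j)) k

/-- The digamma function `ψ = (log ∘ Γ)'`. -/
def digamma (x : ℝ) : ℝ := deriv (fun y => Real.log (Real.Gamma y)) x

/-- Volume of the unit Euclidean ball in `ℝ^m`, `V_m = π^(m/2) / Γ(m/2 + 1)`. -/
def unitBallVol (m : ℕ) : ℝ := Real.pi ^ ((m : ℝ) / 2) / Real.Gamma ((m : ℝ) / 2 + 1)

/-- The Kozachenko–Leonenko `k`-nearest-neighbour entropy estimator
`Ĥ_{N,k} = ψ(N) - ψ(k) + log V_m + (m/N) ∑_{i<N} log ρ_{i,k,N}`. -/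
def entropyEstimator {m : ℕ} (k N : ℕ) (X : ℕ → EuclideanSpace ℝ (Fin m)) : ℝ :=
  digamma N - digamma k + Real.log (unitBallVol m) +
    ((m : ℝ) / N) * ∑ i ∈ Finset.range N, Real.log (nnDist X i k N)

/-- The `k`-nearest-neighbour KL divergence estimator
`D̂ = (m/N) ∑_{i<N} log (ν_{i,k} / ρ_{i,k,N}) + ψ(M) - ψ(N-1)`. -/
def klDivEstimator {m : ℕ} (k N M : ℕ) (X Y : ℕ → EuclideanSpace ℝ (Fin m)) : ℝ :=
  ((m : ℝ) / N) * ∑ i ∈ Finset.range N, Real.log (nnDistTo X Y i k M / nnDist X i k N) +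
    digamma M - digamma (N - 1)

/-- The sample mean `X̄_N`. -/
def sampleMean {m : ℕ} (N : ℕ) (X : ℕ → EuclideanSpace ℝ (Fin m)) :
    EuclideanSpace ℝ (Fin m) :=
  (N : ℝ)⁻¹ • ∑ i ∈ Finset.range N, X i

/-- The sample covariance matrix `S_N`. -/
def sampleCov {m : ℕ} (N : ℕ) (X : ℕ → EuclideanSpace ℝ (Fin m)) :
    Matrix (Fin m) (Fin m) ℝ :=
  fun a b => ((N : ℝ) - 1)⁻¹ *
    ∑ i ∈ Finset.range N, (X i a - sampleMean N X a) * (X i b - sampleMean N X b)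

/-- The KL-based test statistic
`T_{N,k} = (1/2) log ((2πe)^m det S_N) - Ĥ_{N,k}`. -/
def klTestStat {m : ℕ} (k N : ℕ) (X : ℕ → EuclideanSpace ℝ (Fin m)) : ℝ :=
  (1 / 2) * Real.log ((2 * Real.pi * Real.exp 1) ^ m * (sampleCov N X).det) -
    entropyEstimator k N X

/-- The logarithm of the Gaussian density is a constant plus a quadratic form. -/
theorem log_gaussianDensity {m : ℕ} (μ : EuclideanSpace ℝ (Fin m))
    {S : Matrix (Fin m) (Fin m) ℝ} (hS : 0 < S.det) (x : EuclideanSpace ℝ (Fin m)) :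
    Real.log (gaussianDensity μ S x) =
      -(1 / 2) * Real.log ((2 * Real.pi) ^ m * S.det) -
        1 / 2 * ∑ i, ∑ j, S⁻¹ i j * ((x i - μ i) * (x j - μ j)) := by
  have hpi : 0 < 2 * Real.pi := by positivity
  have hquad : (fun i => x i - μ i) ⬝ᵥ (S⁻¹ *ᵥ fun i => x i - μ i) =
      ∑ i, ∑ j, S⁻¹ i j * ((x i - μ i) * (x j - μ j)) := by
    simp only [dotProduct, mulVec, Finset.mul_sum]
    exact Finset.sum_congr rfl fun i _ => Finset.sum_congr rfl fun j _ => by ring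
  rw [gaussianDensity, hquad, Real.log_mul (by positivity) (Real.exp_ne_zero _),
    Real.log_mul (by positivity) (by positivity), Real.log_rpow hpi, Real.log_rpow hS,
    Real.log_exp, Real.log_mul (by positivity) hS.ne', Real.log_pow]
  ring

/-- The expected squared Mahalanobis distance to the mean is the dimension. -/
theorem HasCov.integral_inv_quadraticForm {m : ℕ} {f : EuclideanSpace ℝ (Fin m) → ℝ}
    {μ : EuclideanSpace ℝ (Fin m)} {S : Matrix (Fin m) (Fin m) ℝ}
    (hcov : HasCov f μ S) (hS : S.PosDef) :
    ∫ x, ∑ i, ∑ j, S⁻¹ i j * (f x * ((x i - μ i) * (x j - μ j))) = m := by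
  have hint : ∀ i j, Integrable fun x => S⁻¹ i j * (f x * ((x i - μ i) * (x j - μ j))) :=
    fun i j => (hcov.1 i j).const_mul _
  rw [integral_finsetSum _ fun i _ => integrable_finsetSum _ fun j _ => hint i j]
  simp_rw [integral_finsetSum _ fun j _ => hint _ j, integral_const_mul, hcov.2]
  have htrace : (S⁻¹ * S).trace = m := by
    rw [nonsing_inv_mul _ hS.det_pos.ne'.isUnit, trace_one, Fintype.card_fin]
  rw [← htrace, trace]
  refine Finset.sum_congr rfl fun i _ => ?_
  rw [diag_apply, mul_apply]
  exact Finset.sum_congr rfl fun j _ => by rw [← hS.isHermitian.apply i j, star_trivial]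

/-- For a density `f` with mean `μ` and symmetric positive definite
covariance `Σ`, the cross-entropy integral satisfies
`∫ f(x) log φ_{μ,Σ}(x) dx = -(1/2) log ((2π)^m det Σ) - m/2`. -/
theorem gaussian_cross_entropy_integral {m : ℕ} (f : EuclideanSpace ℝ (Fin m) → ℝ)
    (μ : EuclideanSpace ℝ (Fin m)) (S : Matrix (Fin m) (Fin m) ℝ)
    (hf : IsDensity f) (hmean : HasMean f μ) (hcov : HasCov f μ S) (hS : S.PosDef) :
    (∫ x, f x * Real.log (gaussianDensity μ S x)) =
      -(1 / 2) * Real.log ((2 * Real.pi) ^ m * S.det) - (m : ℝ) / 2 := by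
  have hint : Integrable fun x =>
      ∑ i, ∑ j, S⁻¹ i j * (f x * ((x i - μ i) * (x j - μ j))) :=
    integrable_finsetSum _ fun i _ => integrable_finsetSum _ fun j _ =>
      (hcov.1 i j).const_mul _
  have hsplit : ∀ x, f x * Real.log (gaussianDensity μ S x) =
      -(1 / 2) * Real.log ((2 * Real.pi) ^ m * S.det) * f x -
        1 / 2 * ∑ i, ∑ j, S⁻¹ i j * (f x * ((x i - μ i) * (x j - μ j))) := by
    intro x
    rw [log_gaussianDensity μ hS.det_pos]
    simp only [mul_left_comm _ (f x), ← Finset.mul_sum]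
    ring
  simp_rw [hsplit]
  rw [integral_sub (hf.2.2.1.const_mul _) (hint.const_mul _), integral_const_mul,
    integral_const_mul, hf.2.2.2, hcov.integral_inv_quadraticForm hS]
  ring
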